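/- With R the 9×9 matrix of the deformed oscillator covariance and R' = (q²/Q₁)·R, the pair (R, R') satisfies the mixed Yang–Baxter relations R'₁₂R'₁₃R₂₃ = R₂₃R'₁₃R'₁₂ and R₁₂R'₁₃R'₂₃ = R'₂₃R'₁₃R₁₂ as 27×27 matrices. -/

import Mathlib

/-- The 9×9 R-matrix of the deformed oscillator covariance,
rows/columns indexed by pairs from `Fin 3` (0,1,2 standing for 1,2,3). -/
noncomputable def Rmat {K : Type*} [Field K] (q Q1 : K) :
    Matrix (Fin 3 × Fin 3) (Fin 3 × Fin 3) K := fun r c =>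
  if r = ((0 : Fin 3), (0 : Fin 3)) ∧ c = ((0 : Fin 3), (0 : Fin 3)) then 1
  else if r = (0, 1) ∧ c = (0, 1) then Q1 ^ 2 / q ^ 2
  else if r = (0, 2) ∧ c = (0, 2) then Q1 / q
  else if r = (1, 0) ∧ c = (0, 1) then (q ^ 2 - Q1) / q ^ 2
  else if r = (1, 0) ∧ c = (1, 0) then 1 / Q1
  else if r = (1, 1) ∧ c = (1, 1) then 1
  else if r = (1, 2) ∧ c = (1, 2) then 1 / q
  else if r = (1, 2) ∧ c = (2, 1) then (q ^ 2 - Q1) / q ^ 2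
  else if r = (2, 0) ∧ c = (0, 2) then (q ^ 2 - Q1) / q ^ 2
  else if r = (2, 0) ∧ c = (2, 0) then 1 / q
  else if r = (2, 1) ∧ c = (2, 1) then Q1 / q
  else if r = (2, 2) ∧ c = (0, 1) then Q1 / q ^ 2
  else if r = (2, 2) ∧ c = (1, 0) then -(1 / Q1)
  else if r = (2, 2) ∧ c = (2, 2) then 1
  else 0

/-- `M ⊗ id` acting on the first two tensor factors of `V ⊗ V ⊗ V`. -/
noncomputable def op12 {K : Type*} [Field K]
    (M : Matrix (Fin 3 × Fin 3) (Fin 3 × Fin 3) K) :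
    Matrix (Fin 3 × Fin 3 × Fin 3) (Fin 3 × Fin 3 × Fin 3) K := fun r c =>
  M (r.1, r.2.1) (c.1, c.2.1) * (if r.2.2 = c.2.2 then 1 else 0)

/-- `M` acting on the first and third tensor factors of `V ⊗ V ⊗ V`. -/
noncomputable def op13 {K : Type*} [Field K]
    (M : Matrix (Fin 3 × Fin 3) (Fin 3 × Fin 3) K) :
    Matrix (Fin 3 × Fin 3 × Fin 3) (Fin 3 × Fin 3 × Fin 3) K := fun r c =>
  M (r.1, r.2.2) (c.1, c.2.2) * (if r.2.1 = c.2.1 then 1 else 0)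

/-- `id ⊗ M` acting on the last two tensor factors of `V ⊗ V ⊗ V`. -/
noncomputable def op23 {K : Type*} [Field K]
    (M : Matrix (Fin 3 × Fin 3) (Fin 3 × Fin 3) K) :
    Matrix (Fin 3 × Fin 3 × Fin 3) (Fin 3 × Fin 3 × Fin 3) K := fun r c =>
  (if r.1 = c.1 then 1 else 0) * M (r.2.1, r.2.2) (c.2.1, c.2.2)

/-- Action of `Rmat` on a vector. -/
noncomputable def ybAct {K : Type*} [Field K] (q Q1 : K) (f : Fin 3 → Fin 3 → K) :
    Fin 3 → Fin 3 → K :=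
  ![![f 0 0, Q1 ^ 2 / q ^ 2 * f 0 1, Q1 / q * f 0 2],
    ![(q ^ 2 - Q1) / q ^ 2 * f 0 1 + 1 / Q1 * f 1 0, f 1 1,
      1 / q * f 1 2 + (q ^ 2 - Q1) / q ^ 2 * f 2 1],
    ![(q ^ 2 - Q1) / q ^ 2 * f 0 2 + 1 / q * f 2 0, Q1 / q * f 2 1,
      Q1 / q ^ 2 * f 0 1 - 1 / Q1 * f 1 0 + f 2 2]]

theorem ybAct_eq {K : Type*} [Field K] (q Q1 : K) (f : Fin 3 → Fin 3 → K) (i j : Fin 3) :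
    ∑ a, ∑ b, Rmat q Q1 (i, j) (a, b) * f a b = ybAct q Q1 f i j := by
  fin_cases i <;> fin_cases j <;> simp [Rmat, ybAct, Fin.sum_univ_three] <;> ring

theorem op12_act {K : Type*} [Field K] (q Q1 : K) (v : Fin 3 × Fin 3 × Fin 3 → K) :
    (op12 (Rmat q Q1)).mulVec v =
      fun r => ybAct q Q1 (fun a b => v (a, b, r.2.2)) r.1 r.2.1 := by
  funext r
  simp only [← ybAct_eq, Matrix.mulVec, dotProduct, op12, Fintype.sum_prod_type]
  simp

theorem op13_act {K : Type*} [Field K] (q Q1 : K) (v : Fin 3 × Fin 3 × Fin 3 → K) :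
    (op13 (Rmat q Q1)).mulVec v =
      fun r => ybAct q Q1 (fun a b => v (a, r.2.1, b)) r.1 r.2.2 := by
  funext r
  simp only [← ybAct_eq, Matrix.mulVec, dotProduct, op13, Fintype.sum_prod_type]
  refine Finset.sum_congr rfl fun a _ => ?_
  rw [Finset.sum_comm]
  simp

theorem op23_act {K : Type*} [Field K] (q Q1 : K) (v : Fin 3 × Fin 3 × Fin 3 → K) :
    (op23 (Rmat q Q1)).mulVec v =
      fun r => ybAct q Q1 (fun a b => v (r.1, a, b)) r.2.1 r.2.2 := by
  funext r
  simp only [← ybAct_eq, Matrix.mulVec, dotProduct, op23, Fintype.sum_prod_type]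
  rw [Finset.sum_eq_single r.1]
  · simp
  · intro b _ hb
    simp [Ne.symm hb]
  · simp

theorem ybAct_00 {K : Type*} [Field K] (q Q1 : K) (f : Fin 3 → Fin 3 → K) :
    ybAct q Q1 f 0 0 = f 0 0 := rfl

theorem ybAct_01 {K : Type*} [Field K] (q Q1 : K) (f : Fin 3 → Fin 3 → K) :
    ybAct q Q1 f 0 1 = Q1 ^ 2 / q ^ 2 * f 0 1 := rfl

theorem ybAct_02 {K : Type*} [Field K] (q Q1 : K) (f : Fin 3 → Fin 3 → K) :
    ybAct q Q1 f 0 2 = Q1 / q * f 0 2 := rfl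

theorem ybAct_10 {K : Type*} [Field K] (q Q1 : K) (f : Fin 3 → Fin 3 → K) :
    ybAct q Q1 f 1 0 = (q ^ 2 - Q1) / q ^ 2 * f 0 1 + 1 / Q1 * f 1 0 := rfl

theorem ybAct_11 {K : Type*} [Field K] (q Q1 : K) (f : Fin 3 → Fin 3 → K) :
    ybAct q Q1 f 1 1 = f 1 1 := rfl

theorem ybAct_12 {K : Type*} [Field K] (q Q1 : K) (f : Fin 3 → Fin 3 → K) :
    ybAct q Q1 f 1 2 = 1 / q * f 1 2 + (q ^ 2 - Q1) / q ^ 2 * f 2 1 := rfl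

theorem ybAct_20 {K : Type*} [Field K] (q Q1 : K) (f : Fin 3 → Fin 3 → K) :
    ybAct q Q1 f 2 0 = (q ^ 2 - Q1) / q ^ 2 * f 0 2 + 1 / q * f 2 0 := rfl

theorem ybAct_21 {K : Type*} [Field K] (q Q1 : K) (f : Fin 3 → Fin 3 → K) :
    ybAct q Q1 f 2 1 = Q1 / q * f 2 1 := rfl

theorem ybAct_22 {K : Type*} [Field K] (q Q1 : K) (f : Fin 3 → Fin 3 → K) :
    ybAct q Q1 f 2 2 = Q1 / q ^ 2 * f 0 1 - 1 / Q1 * f 1 0 + f 2 2 := rfl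

set_option maxHeartbeats 4000000 in
theorem yb_plain {K : Type*} [Field K] (q Q1 : K) (hq : q ≠ 0) (hQ1 : Q1 ≠ 0) :
    op12 (Rmat q Q1) * op13 (Rmat q Q1) * op23 (Rmat q Q1) =
      op23 (Rmat q Q1) * op13 (Rmat q Q1) * op12 (Rmat q Q1) := by
  apply Matrix.mulVec_injective
  funext v
  simp only [← Matrix.mulVec_mulVec, op12_act, op13_act, op23_act]
  funext r
  obtain ⟨i, j, k⟩ := r
  dsimp only
  revert i j k
  simp only [Fin.forall_fin_succ, IsEmpty.forall_iff, and_true,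
    Fin.succ_zero_eq_one, Fin.succ_one_eq_two,
    ybAct_00, ybAct_01, ybAct_02, ybAct_10, ybAct_11, ybAct_12, ybAct_20, ybAct_21, ybAct_22]
  repeat' apply And.intro
  all_goals first | trivial | (field_simp; done) | (field_simp; ring)

theorem op12_smul {K : Type*} [Field K] (c : K)
    (M : Matrix (Fin 3 × Fin 3) (Fin 3 × Fin 3) K) : op12 (c • M) = c • op12 M := by
  ext r s
  simp [op12]

theorem op13_smul {K : Type*} [Field K] (c : K)
    (M : Matrix (Fin 3 × Fin 3) (Fin 3 × Fin 3) K) : op13 (c • M) = c • op13 M := by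
  ext r s
  simp [op13]

theorem op23_smul {K : Type*} [Field K] (c : K)
    (M : Matrix (Fin 3 × Fin 3) (Fin 3 × Fin 3) K) : op23 (c • M) = c • op23 M := by
  ext r s
  simp [op23]

/-- with `R' = (q²/Q₁) • R`, the pair `(R, R')` satisfies the mixed
Yang–Baxter relations `R'₁₂ R'₁₃ R₂₃ = R₂₃ R'₁₃ R'₁₂` and
`R₁₂ R'₁₃ R'₂₃ = R'₂₃ R'₁₃ R₁₂` as 27×27 matrices. -/
theorem Rmat_mixed_yang_baxter {K : Type*} [Field K] (q Q1 : K)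
    (hq : q ≠ 0) (hQ1 : Q1 ≠ 0) :
    (op12 ((q ^ 2 / Q1) • Rmat q Q1) * op13 ((q ^ 2 / Q1) • Rmat q Q1) *
        op23 (Rmat q Q1) =
      op23 (Rmat q Q1) * op13 ((q ^ 2 / Q1) • Rmat q Q1) *
        op12 ((q ^ 2 / Q1) • Rmat q Q1)) ∧
    (op12 (Rmat q Q1) * op13 ((q ^ 2 / Q1) • Rmat q Q1) *
        op23 ((q ^ 2 / Q1) • Rmat q Q1) =
      op23 ((q ^ 2 / Q1) • Rmat q Q1) * op13 ((q ^ 2 / Q1) • Rmat q Q1) *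
        op12 (Rmat q Q1)) := by
  simp only [op12_smul, op13_smul, op23_smul, Matrix.smul_mul, Matrix.mul_smul,
    yb_plain q Q1 hq hQ1, and_self]
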